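/- arXiv:2409.14529 — 2 statements merged into one kernel-verified Lean document; each statement's English description precedes it below -/
import Mathlib

section
/- Let μ be a real number and let q : ℝ → ℝ be continuous on [0,1) and differentiable on (0,1) with q'(t) ≤ −q(t)² for all t ∈ (0,1). Assume q(0) ≤ μ and 1 + t·μ > 0 for all t ∈ [0,1). Then q(t) ≤ μ/(1 + t·μ) for all t ∈ [0,1). -/
/-- A continuous function on `[0, b]` has there a continuous primitive. -/
theorem ContinuousOn.exists_primitive_Icc {q : ℝ → ℝ} {b : ℝ} (hb : 0 ≤ b)
    (hq : ContinuousOn q (Set.Icc 0 b)) :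
    ∃ Q : ℝ → ℝ, ContinuousOn Q (Set.Icc 0 b) ∧
      ∀ s ∈ Set.Ioo 0 b, HasDerivAt Q (q s) s := by
  refine ⟨fun t => ∫ x in (0 : ℝ)..t, q x, ?_, fun s hs => ?_⟩
  · have h := intervalIntegral.continuousOn_primitive_interval (f := q)
      (μ := MeasureTheory.volume) (a := 0) (b := b)
      (by rw [Set.uIcc_of_le hb]; exact hq.integrableOn_Icc)
    rwa [Set.uIcc_of_le hb] at h
  · have hq' : ContinuousOn q (Set.Ioo 0 b) := hq.mono Set.Ioo_subset_Icc_self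
    refine intervalIntegral.integral_hasDerivAt_right ?_
      (hq'.stronglyMeasurableAtFilter isOpen_Ioo s hs)
      (hq'.continuousAt (isOpen_Ioo.mem_nhds hs))
    apply ContinuousOn.intervalIntegrable
    rw [Set.uIcc_of_le hs.1.le]
    exact hq.mono (Set.Icc_subset_Icc_right hs.2.le)

theorem riccati_comparison (μ : ℝ) (q : ℝ → ℝ)
    (hq_cont : ContinuousOn q (Set.Ico 0 1))
    (hq_diff : ∀ t ∈ Set.Ioo (0 : ℝ) 1, DifferentiableAt ℝ q t)
    (hq_deriv : ∀ t ∈ Set.Ioo (0 : ℝ) 1, deriv q t ≤ -(q t) ^ 2)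
    (h0 : q 0 ≤ μ)
    (hμ : ∀ t ∈ Set.Ico (0 : ℝ) 1, 0 < 1 + t * μ) :
    ∀ t ∈ Set.Ico (0 : ℝ) 1, q t ≤ μ / (1 + t * μ) := by
  intro t ht
  have hq : ContinuousOn q (Set.Icc 0 t) := hq_cont.mono (Set.Icc_subset_Ico_right ht.2)
  obtain ⟨Q, hQ_cont, hQ_deriv⟩ := hq.exists_primitive_Icc ht.1
  have h_anti : AntitoneOn (fun s => (q s * (1 + s * μ) - μ) * Real.exp (Q s))
      (Set.Icc 0 t) := by
    refine antitoneOn_of_hasDerivWithinAt_nonpos (convex_Icc 0 t)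
      (f' := fun s => (deriv q s + q s ^ 2) * (1 + s * μ) * Real.exp (Q s))
      (by fun_prop) (fun s hs => ?_) (fun s hs => ?_)
    all_goals
      rw [interior_Icc] at hs
      have hs1 : s ∈ Set.Ioo (0 : ℝ) 1 := ⟨hs.1, hs.2.trans ht.2⟩
    · have h_lin : HasDerivAt (fun s : ℝ => 1 + s * μ) (1 * μ) s :=
        ((hasDerivAt_id s).mul_const μ).const_add 1
      refine (((((hq_diff s hs1).hasDerivAt.fun_mul h_lin).sub_const μ).fun_mul
        (hQ_deriv s hs).exp).congr_deriv ?_).hasDerivWithinAt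
      ring
    · have h_le : deriv q s + q s ^ 2 ≤ 0 := by linarith [hq_deriv s hs1]
      exact mul_nonpos_of_nonpos_of_nonneg
        (mul_nonpos_of_nonpos_of_nonneg h_le (hμ s ⟨hs1.1.le, hs1.2⟩).le)
        (Real.exp_pos _).le
  have h_init : (q 0 * (1 + 0 * μ) - μ) * Real.exp (Q 0) ≤ 0 :=
    mul_nonpos_of_nonpos_of_nonneg (by linarith) (Real.exp_pos _).le
  have h_final := (h_anti (Set.left_mem_Icc.2 ht.1) (Set.right_mem_Icc.2 ht.1) ht.1).trans h_init
  rw [le_div_iff₀ (hμ t ht)]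
  exact sub_nonpos.1 (nonpos_of_mul_nonpos_left h_final (Real.exp_pos _))
end

section
/- Let n ≥ 1. Let S : [0,1] → Mₙ(ℝ) be continuous with S(t) symmetric positive semidefinite for every t ∈ [0,1]. Let P : [0,1] → Mₙ(ℝ) be twice differentiable with P''(t) = −P(t)·S(t) for all t ∈ (0,1), P(0) = I, P'(0) = B where B is symmetric and I + B is positive semidefinite, and suppose P(t) is invertible for every t ∈ (0,1). Then det P(1) ≤ det(I + B). -/
open Set Filter Topology Matrix

/-- If the derivative `f'` of a function on `[0, 1]` itself has a bounded derivative in the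
interior, then `f'` is continuous at the left endpoint. -/
theorem continuousWithinAt_deriv_zero_of_bounded {f f' f'' : ℝ → ℝ} {C : ℝ}
    (hf : ∀ t ∈ Icc (0 : ℝ) 1, HasDerivWithinAt f (f' t) (Icc 0 1) t)
    (hf' : ∀ t ∈ Ioo (0 : ℝ) 1, HasDerivAt f' (f'' t) t)
    (hC : ∀ t ∈ Ioo (0 : ℝ) 1, |f'' t| ≤ C) :
    ContinuousWithinAt f' (Ico 0 1) 0 := by
  have hlip : ∀ u ∈ Ioo (0 : ℝ) 1, ∀ s ∈ Ioo (0 : ℝ) 1, |f' u - f' s| ≤ C * |u - s| := by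
    intro u hu s hs
    exact (convex_Ioo (0 : ℝ) 1).norm_image_sub_le_of_norm_hasDerivWithin_le
      (fun x hx => (hf' x hx).hasDerivWithinAt) hC hs hu
  have hC0 : 0 ≤ C := (abs_nonneg _).trans (hC (1 / 2) (by norm_num))
  have hbound : ∀ s ∈ Ioo (0 : ℝ) 1, |f' 0 - f' s| ≤ C * s := by
    intro s hs
    have h0 : Tendsto (slope f 0) (𝓝[>] 0) (𝓝 (f' 0)) := by
      have h := hf 0 (by simp)
      rw [hasDerivWithinAt_iff_tendsto_slope] at h
      refine h.mono_left ?_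
      rw [← nhdsWithin_Ioo_eq_nhdsGT (zero_lt_one' ℝ)]
      exact nhdsWithin_mono _ fun x hx => ⟨Ioo_subset_Icc_self hx, hx.1.ne'⟩
    refine le_of_tendsto (h0.sub_const (f' s)).abs ?_
    filter_upwards [Ioo_mem_nhdsGT hs.1] with u hu
    have hu1 : u < 1 := hu.2.trans hs.2
    obtain ⟨c, hc, hcs⟩ := exists_hasDerivAt_eq_slope f f' hu.1
      (fun x hx => (hf x ⟨hx.1, hx.2.trans hu1.le⟩).continuousWithinAt.mono
        (Icc_subset_Icc_right hu1.le))
      (fun x hx => (hf x ⟨hx.1.le, (hx.2.trans hu1).le⟩).hasDerivAt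
        (Icc_mem_nhds hx.1 (hx.2.trans hu1)))
    rw [slope_def_field, ← hcs]
    refine (hlip c ⟨hc.1, hc.2.trans hu1⟩ s hs).trans ?_
    gcongr
    rw [abs_le]
    constructor <;> linarith [hc.1, hc.2, hu.2]
  rw [ContinuousWithinAt, tendsto_iff_dist_tendsto_zero]
  refine squeeze_zero' (g := fun s => C * s) (Eventually.of_forall fun _ => dist_nonneg) ?_ ?_
  · filter_upwards [self_mem_nhdsWithin] with s hs
    rcases hs.1.eq_or_lt with rfl | h
    · simp
    · rw [dist_comm, Real.dist_eq]
      exact hbound s ⟨h, hs.2⟩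
  · have : Continuous fun s : ℝ => C * s := by fun_prop
    simpa using (this.tendsto 0).mono_left nhdsWithin_le_nhds

namespace Matrix

variable {ι : Type*} [Fintype ι] [DecidableEq ι]

/-- Jacobi's formula for the derivative of a determinant. -/
theorem hasDerivAt_det {M : ℝ → Matrix ι ι ℝ} {M' : Matrix ι ι ℝ} {t : ℝ}
    (h : ∀ i j, HasDerivAt (fun s => M s i j) (M' i j) t) :
    HasDerivAt (fun s => (M s).det) ((adjugate (M t) * M').trace) t := by
  have key : (adjugate (M t) * M').trace =
      ∑ σ : Equiv.Perm ι, ((Equiv.Perm.sign σ : ℤ) : ℝ) *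
        ∑ i, (∏ k ∈ Finset.univ.erase i, M t (σ k) k) • M' (σ i) i := by
    have h1 : ∀ i, (adjugate (M t) * M') i i = ((M t).updateCol i (fun j => M' j i)).det := by
      intro i
      rw [← cramer_apply, cramer_eq_adjugate_mulVec]
      rfl
    simp only [trace, diag_apply, h1, det_apply']
    rw [Finset.sum_comm]
    refine Finset.sum_congr rfl fun σ _ => ?_
    rw [Finset.mul_sum]
    refine Finset.sum_congr rfl fun i _ => ?_
    rw [← Finset.prod_erase_mul _ _ (Finset.mem_univ i), updateCol_self, smul_eq_mul]
    congr 2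
    exact Finset.prod_congr rfl fun k hk => updateCol_ne (Finset.ne_of_mem_erase hk)
  rw [key]
  simp only [det_apply']
  exact HasDerivAt.fun_sum fun σ _ =>
    (HasDerivAt.fun_finsetProd fun i _ => h (σ i) i).const_mul _

theorem hasDerivAt_det_of_isUnit {M : ℝ → Matrix ι ι ℝ} {M' : Matrix ι ι ℝ} {t : ℝ}
    (h : ∀ i j, HasDerivAt (fun s => M s i j) (M' i j) t) (hM : IsUnit (M t)) :
    HasDerivAt (fun s => (M s).det) ((M t).det * ((M t)⁻¹ * M').trace) t := by
  have hdet : (M t).det ≠ 0 := ((isUnit_iff_isUnit_det _).1 hM).ne_zero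
  convert hasDerivAt_det h using 1
  rw [inv_def, Ring.inverse_eq_inv', smul_mul_assoc, trace_smul, smul_eq_mul,
    mul_inv_cancel_left₀ hdet]

section Normed

attribute [local instance] Matrix.linftyOpNormedRing Matrix.linftyOpNormedAlgebra

theorem hasDerivAt_of_entries {M : ℝ → Matrix ι ι ℝ} {M' : Matrix ι ι ℝ} {t : ℝ}
    (h : ∀ i j, HasDerivAt (fun s => M s i j) (M' i j) t) : HasDerivAt M M' t := by
  have h1 : M = fun s => ∑ i, ∑ j, M s i j • single i j (1 : ℝ) := by
    funext s
    simpa using matrix_eq_sum_single (M s)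
  have h2 : M' = ∑ i, ∑ j, M' i j • single i j (1 : ℝ) := by
    simpa using matrix_eq_sum_single M'
  rw [h1, h2]
  exact HasDerivAt.fun_sum fun i _ => HasDerivAt.fun_sum fun j _ => (h i j).smul_const _

theorem continuousWithinAt_of_entries {M : ℝ → Matrix ι ι ℝ} {s : Set ℝ} {t : ℝ}
    (h : ∀ i j, ContinuousWithinAt (fun s => M s i j) s t) : ContinuousWithinAt M s t := by
  have h1 : M = fun s => ∑ i, ∑ j, M s i j • single i j (1 : ℝ) := by
    funext s
    simpa using matrix_eq_sum_single (M s)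
  rw [h1]
  exact tendsto_finsetSum _ fun i _ => tendsto_finsetSum _ fun j _ => (h i j).smul_const _

theorem _root_.HasDerivAt.matrix_inv {M : ℝ → Matrix ι ι ℝ} {M' : Matrix ι ι ℝ} {t : ℝ}
    (h : HasDerivAt M M' t) (hM : IsUnit (M t)) :
    HasDerivAt (fun s => (M s)⁻¹) (-((M t)⁻¹ * M' * (M t)⁻¹)) t := by
  obtain ⟨u, hu⟩ := hM
  have h1 := hasFDerivAt_ringInverse (𝕜 := ℝ) u
  rw [hu] at h1
  have h2 := h1.comp_hasDerivAt t h
  simp only [nonsing_inv_eq_ringInverse]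
  refine h2.congr_deriv ?_
  rw [← hu, Ring.inverse_unit]
  rfl

theorem _root_.ContinuousWithinAt.matrix_inv {M : ℝ → Matrix ι ι ℝ} {s : Set ℝ} {t : ℝ}
    (h : ContinuousWithinAt M s t) (hM : IsUnit (M t)) :
    ContinuousWithinAt (fun s => (M s)⁻¹) s t := by
  obtain ⟨u, hu⟩ := hM
  simp only [nonsing_inv_eq_ringInverse]
  have h1 := NormedRing.inverse_continuousAt u
  rw [hu] at h1
  exact h1.comp_continuousWithinAt h

/-- A curve of matrices starting at zero whose derivative is positive semidefinite stays positive
semidefinite. -/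
theorem dotProduct_mulVec_nonneg_of_hasDerivAt {F F' : ℝ → Matrix ι ι ℝ}
    (hF : ContinuousOn F (Ico 0 1)) (hF' : ∀ t ∈ Ioo (0 : ℝ) 1, HasDerivAt F (F' t) t)
    (hpsd : ∀ t ∈ Ioo (0 : ℝ) 1, (F' t).PosSemidef) (h0 : F 0 = 0)
    {t : ℝ} (ht : t ∈ Ico (0 : ℝ) 1) (x : ι → ℝ) : 0 ≤ x ⬝ᵥ F t *ᵥ x := by
  let L : Matrix ι ι ℝ →ₗ[ℝ] ℝ :=
    { toFun := fun M => x ⬝ᵥ M *ᵥ x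
      map_add' := fun M N => by simp [add_mulVec]
      map_smul' := fun c M => by simp [smul_mulVec] }
  let Lc : Matrix ι ι ℝ →L[ℝ] ℝ := LinearMap.toContinuousLinearMap L
  have hmono : MonotoneOn (fun s => Lc (F s)) (Ico 0 1) := by
    refine monotoneOn_of_hasDerivWithinAt_nonneg (convex_Ico 0 1) (f' := fun s => Lc (F' s))
      (Lc.continuous.comp_continuousOn hF) ?_ ?_
    · rw [interior_Ico]
      exact fun s hs => (Lc.hasFDerivAt.comp_hasDerivAt s (hF' s hs)).hasDerivWithinAt
    · rw [interior_Ico]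
      intro s hs
      exact (hpsd s hs).dotProduct_mulVec_nonneg x
  have h := hmono ⟨le_rfl, zero_lt_one⟩ ht ht.1
  simp only [h0, map_zero] at h
  exact h

theorem eqOn_of_hasDerivAt_zero {F : ℝ → Matrix ι ι ℝ}
    (hF : ContinuousOn F (Ico 0 1)) (hF' : ∀ t ∈ Ioo (0 : ℝ) 1, HasDerivAt F 0 t)
    {t : ℝ} (ht : t ∈ Ico (0 : ℝ) 1) : F t = F 0 := by
  rcases ht.1.eq_or_lt with rfl | h0
  · rfl
  have hsub : Icc 0 t ⊆ Ico (0 : ℝ) 1 := fun s hs => ⟨hs.1, hs.2.trans_lt ht.2⟩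
  ext i j
  let Lc : Matrix ι ι ℝ →L[ℝ] ℝ := LinearMap.toContinuousLinearMap (entryLinearMap ℝ ℝ i j)
  obtain ⟨c, -, hc⟩ := exists_hasDerivAt_eq_slope (fun s => Lc (F s)) (fun _ => Lc 0) h0
    (Lc.continuous.comp_continuousOn (hF.mono hsub))
    (fun s hs => Lc.hasFDerivAt.comp_hasDerivAt s (hF' s ⟨hs.1, hs.2.trans ht.2⟩))
  rw [map_zero, eq_comm, div_eq_zero_iff, sub_zero, or_iff_left h0.ne', sub_eq_zero] at hc
  exact hc

theorem posDef_one_add_smul {κ : Type*} [DecidableEq κ] {B : Matrix κ κ ℝ} (hB : (1 + B).PosSemidef) {t : ℝ}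
    (ht : t ∈ Ico (0 : ℝ) 1) : (1 + t • B).PosDef := by
  have h : 1 + t • B = (1 - t) • (1 : Matrix κ κ ℝ) + t • (1 + B) := by
    rw [smul_add, sub_smul, one_smul]; abel
  rw [h]
  exact (PosDef.one.smul (sub_pos.2 ht.2)).add_posSemidef (hB.smul ht.1)

/-- Riccati comparison: the logarithmic derivative `P⁻¹ P'` of a solution of `P'' = -P S` with
`S ≥ 0` has trace at most that of the logarithmic derivative of `1 + t B`. -/
theorem trace_inv_mul_le_of_jacobi {S P P' : ℝ → Matrix ι ι ℝ} {B : Matrix ι ι ℝ}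
    (hS : ∀ t ∈ Ioo (0 : ℝ) 1, (S t).PosSemidef)
    (hPc : ContinuousOn P (Ico 0 1)) (hP'c : ContinuousOn P' (Ico 0 1))
    (hP : ∀ t ∈ Ioo (0 : ℝ) 1, HasDerivAt P (P' t) t)
    (hP' : ∀ t ∈ Ioo (0 : ℝ) 1, HasDerivAt P' (-(P t * S t)) t)
    (hP0 : P 0 = 1) (hP'0 : P' 0 = B) (hBs : B.IsSymm) (hB : (1 + B).PosSemidef)
    (hu : ∀ t ∈ Ico (0 : ℝ) 1, IsUnit (P t)) {t : ℝ} (ht : t ∈ Ico (0 : ℝ) 1) :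
    ((P t)⁻¹ * P' t).trace ≤ ((1 + t • B)⁻¹ * B).trace := by
  let T : Matrix ι ι ℝ →L[ℝ] Matrix ι ι ℝ :=
    LinearMap.toContinuousLinearMap (transposeLinearEquiv ι ι ℝ ℝ).toLinearMap
  have hT : ∀ M, T M = Mᵀ := fun _ => rfl
  have hSs : ∀ t ∈ Ioo (0 : ℝ) 1, (S t)ᵀ = S t := fun t ht => (hS t ht).isHermitian
  -- the Wronskian vanishes
  have hW : ∀ t ∈ Ico (0 : ℝ) 1, P t * (P' t)ᵀ = P' t * (P t)ᵀ := by
    intro t ht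
    have h := eqOn_of_hasDerivAt_zero (F := fun s => P s * T (P' s) - P' s * T (P s))
      ((hPc.mul (T.continuous.comp_continuousOn hP'c)).sub
        (hP'c.mul (T.continuous.comp_continuousOn hPc)))
      (fun s hs => by
        refine (((hP s hs).mul (T.hasFDerivAt.comp_hasDerivAt s (hP' s hs))).sub
          ((hP' s hs).mul (T.hasFDerivAt.comp_hasDerivAt s (hP s hs)))).congr_deriv ?_
        change P' s * (P' s)ᵀ + P s * (-(P s * S s))ᵀ -
          (-(P s * S s) * (P s)ᵀ + P' s * (P' s)ᵀ) = 0
        rw [transpose_neg, transpose_mul, hSs s hs]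
        noncomm_ring) ht
    simp only [hT, hP0, hP'0, hBs.eq, transpose_one, mul_one, one_mul, sub_self] at h
    exact sub_eq_zero.1 h
  set U : ℝ → Matrix ι ι ℝ := fun s => (P s)⁻¹ * P' s with hU
  set A : ℝ → Matrix ι ι ℝ := fun s => 1 + s • B with hA
  have hAs : ∀ s, (A s)ᵀ = A s := fun s => by
    simp [hA, transpose_add, transpose_smul, hBs.eq]
  have hAB : ∀ s, A s * B = B * A s := fun s => by simp [hA, add_mul, mul_add]
  have hUs : ∀ s ∈ Ico (0 : ℝ) 1, (U s)ᵀ = U s := by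
    intro s hs
    have hd := (isUnit_iff_isUnit_det _).1 (hu s hs)
    have hdT : IsUnit (P s)ᵀ.det := by rwa [det_transpose]
    have h : (P s)⁻¹ * (P s * (P' s)ᵀ) * (P s)ᵀ⁻¹ = (P s)⁻¹ * (P' s * (P s)ᵀ) * (P s)ᵀ⁻¹ := by
      rw [hW s hs]
    rw [nonsing_inv_mul_cancel_left _ _ hd, ← mul_assoc, mul_nonsing_inv_cancel_right _ _ hdT] at h
    simp only [hU, transpose_mul, transpose_nonsing_inv]
    exact h
  have hAd : ∀ s, HasDerivAt A B s := fun s =>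
    (((hasDerivAt_id s).smul_const B).const_add (1 : Matrix ι ι ℝ)).congr_deriv (one_smul ℝ B)
  have hAc : ContinuousOn A (Ico 0 1) := fun s _ => (hAd s).continuousAt.continuousWithinAt
  have hUc : ContinuousOn U (Ico 0 1) := fun s hs =>
    ((hPc s hs).matrix_inv (hu s hs)).mul (hP'c s hs)
  have hUd : ∀ s ∈ Ioo (0 : ℝ) 1, HasDerivAt U (-(U s * U s) - S s) s := by
    intro s hs
    have hus := hu s (Ioo_subset_Ico_self hs)
    refine (((hP s hs).matrix_inv hus).mul (hP' s hs)).congr_deriv ?_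
    rw [mul_neg, nonsing_inv_mul_cancel_left _ _ ((isUnit_iff_isUnit_det _).1 hus)]
    simp only [hU]
    noncomm_ring
  let D : ℝ → Matrix ι ι ℝ := fun s => U s * A s - B
  have hq := dotProduct_mulVec_nonneg_of_hasDerivAt (F := fun s => A s * B - A s * U s * A s)
    (F' := fun s => (D s)ᴴ * D s + (A s)ᴴ * S s * A s)
    ((hAc.mul continuousOn_const).sub ((hAc.mul hUc).mul hAc))
    (fun s hs => by
      refine (((hAd s).mul_const B).sub (((hAd s).mul (hUd s hs)).mul (hAd s))).congr_deriv ?_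
      simp only [D, Pi.mul_apply, conjTranspose_eq_transpose_of_trivial, transpose_sub,
        transpose_mul, hAs, hUs s (Ioo_subset_Ico_self hs), hBs.eq]
      noncomm_ring)
    (fun s hs => (posSemidef_conjTranspose_mul_self _).add
      ((hS s hs).conjTranspose_mul_mul_same _))
    (by simp [hA, hU, hP0, hP'0]) ht
  have hF : (A t * B - A t * U t * A t).PosSemidef := by
    refine PosSemidef.of_dotProduct_mulVec_nonneg ?_ fun x => by simpa using hq x
    rw [IsHermitian, conjTranspose_eq_transpose_of_trivial]
    simp only [transpose_sub, transpose_mul, hAs, hUs t ht, hBs.eq, hAB, mul_assoc]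
  have hAu := (isUnit_iff_isUnit_det _).1 (posDef_one_add_smul hB ht).isUnit
  have htr := (hF.conjTranspose_mul_mul_same (A t)⁻¹).trace_nonneg
  have heq : ((A t)⁻¹)ᴴ * (A t * B - A t * U t * A t) * (A t)⁻¹ = B * (A t)⁻¹ - U t := by
    rw [conjTranspose_eq_transpose_of_trivial, transpose_nonsing_inv, hAs, mul_sub, sub_mul,
      nonsing_inv_mul_cancel_left _ _ hAu, mul_assoc (A t) (U t),
      nonsing_inv_mul_cancel_left _ _ hAu, mul_nonsing_inv_cancel_right _ _ hAu]
  rw [heq, trace_sub, trace_mul_comm B] at htr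
  exact sub_nonneg.1 htr

/-- The determinant comparison on the half-open interval `[0, 1)`. -/
theorem det_le_det_one_add_smul_of_jacobi {S P P' : ℝ → Matrix ι ι ℝ} {B : Matrix ι ι ℝ}
    (hS : ∀ t ∈ Ioo (0 : ℝ) 1, (S t).PosSemidef)
    (hPc : ∀ i j, ContinuousOn (fun s => P s i j) (Ico 0 1))
    (hP'c : ∀ i j, ContinuousOn (fun s => P' s i j) (Ico 0 1))
    (hP : ∀ t ∈ Ioo (0 : ℝ) 1, ∀ i j, HasDerivAt (fun s => P s i j) (P' t i j) t)
    (hP' : ∀ t ∈ Ioo (0 : ℝ) 1, ∀ i j, HasDerivAt (fun s => P' s i j) ((-(P t * S t)) i j) t)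
    (hP0 : P 0 = 1) (hP'0 : P' 0 = B) (hBs : B.IsSymm) (hB : (1 + B).PosSemidef)
    (hu : ∀ t ∈ Ico (0 : ℝ) 1, IsUnit (P t)) {t : ℝ} (ht : t ∈ Ico (0 : ℝ) 1) :
    (P t).det ≤ (1 + t • B).det := by
  have htr : ∀ s ∈ Ico (0 : ℝ) 1, ((P s)⁻¹ * P' s).trace ≤ ((1 + s • B)⁻¹ * B).trace :=
    fun s hs => trace_inv_mul_le_of_jacobi hS
      (fun s hs => continuousWithinAt_of_entries fun i j => hPc i j s hs)
      (fun s hs => continuousWithinAt_of_entries fun i j => hP'c i j s hs)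
      (fun s hs => hasDerivAt_of_entries (hP s hs))
      (fun s hs => hasDerivAt_of_entries (hP' s hs)) hP0 hP'0 hBs hB hu hs
  have hdc : ContinuousOn (fun s => (P s).det) (Ico 0 1) := by
    simp only [det_apply']
    exact continuousOn_finsetSum _ fun σ _ =>
      continuousOn_const.mul (continuousOn_finsetProd _ fun i _ => hPc _ _)
  have hne : ∀ s ∈ Ico (0 : ℝ) 1, (P s).det ≠ 0 := fun s hs =>
    ((isUnit_iff_isUnit_det _).1 (hu s hs)).ne_zero
  have h0mem : (0 : ℝ) ∈ Ico (0 : ℝ) 1 := ⟨le_rfl, zero_lt_one⟩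
  have hpos : ∀ s ∈ Ico (0 : ℝ) 1, 0 < (P s).det := by
    intro s hs
    by_contra hneg
    obtain ⟨c, hc, hc0⟩ := isPreconnected_Ico.intermediate_value hs h0mem hdc
      (⟨not_lt.1 hneg, by simp [hP0]⟩ : (0 : ℝ) ∈ Icc _ _)
    exact hne c hc hc0
  have hgpos : ∀ s ∈ Ico (0 : ℝ) 1, 0 < (1 + s • B).det := fun s hs =>
    (posDef_one_add_smul hB hs).det_pos
  have hAd : ∀ s i j, HasDerivAt (fun r : ℝ => (1 + r • B) i j) (B i j) s := by
    intro s i j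
    simpa using ((hasDerivAt_id s).mul_const (B i j)).const_add ((1 : Matrix ι ι ℝ) i j)
  have hgd := fun s (hs : s ∈ Ico (0 : ℝ) 1) =>
    hasDerivAt_det_of_isUnit (hAd s) (posDef_one_add_smul hB hs).isUnit
  have hanti : AntitoneOn (fun s => (P s).det / (1 + s • B).det) (Ico 0 1) := by
    refine antitoneOn_of_hasDerivWithinAt_nonpos (convex_Ico 0 1)
      (f' := fun s => (P s).det / (1 + s • B).det *
        (((P s)⁻¹ * P' s).trace - ((1 + s • B)⁻¹ * B).trace))
      (hdc.div (fun s hs => (hgd s hs).continuousAt.continuousWithinAt)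
        fun s hs => (hgpos s hs).ne') ?_ ?_
    · rw [interior_Ico]
      intro s hs
      have hs' := Ioo_subset_Ico_self hs
      have hg := (hgpos s hs').ne'
      refine HasDerivAt.hasDerivWithinAt ?_
      refine ((hasDerivAt_det_of_isUnit (hP s hs) (hu s hs')).fun_div (hgd s hs') hg).congr_deriv ?_
      field_simp
    · rw [interior_Ico]
      intro s hs
      have hs' := Ioo_subset_Ico_self hs
      exact mul_nonpos_of_nonneg_of_nonpos (div_pos (hpos s hs') (hgpos s hs')).le
        (sub_nonpos.2 (htr s hs'))
  have h := hanti h0mem ht ht.1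
  simp only [hP0, zero_smul, add_zero, det_one, div_one] at h
  exact (div_le_one (hgpos t ht)).1 h

end Normed

end Matrix

theorem matrix_jacobi_ode_det_bound (n : ℕ) (hn : 1 ≤ n)
    (S : ℝ → Matrix (Fin n) (Fin n) ℝ)
    (hS_cont : ∀ i j, ContinuousOn (fun t => S t i j) (Set.Icc 0 1))
    (hS_psd : ∀ t ∈ Set.Icc (0 : ℝ) 1, (S t).PosSemidef)
    (P P' : ℝ → Matrix (Fin n) (Fin n) ℝ)
    (hP : ∀ t ∈ Set.Icc (0 : ℝ) 1, ∀ i j,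
      HasDerivWithinAt (fun s => P s i j) (P' t i j) (Set.Icc 0 1) t)
    (hP'' : ∀ t ∈ Set.Ioo (0 : ℝ) 1, ∀ i j,
      HasDerivWithinAt (fun s => P' s i j) ((-(P t * S t)) i j) (Set.Icc 0 1) t)
    (B : Matrix (Fin n) (Fin n) ℝ)
    (hP0 : P 0 = 1) (hP'0 : P' 0 = B)
    (hB_symm : B.IsSymm) (hB_psd : ((1 : Matrix (Fin n) (Fin n) ℝ) + B).PosSemidef)
    (hP_inv : ∀ t ∈ Set.Ioo (0 : ℝ) 1, IsUnit (P t)) :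
    (P 1).det ≤ ((1 : Matrix (Fin n) (Fin n) ℝ) + B).det := by
  have hnhds : ∀ t ∈ Ioo (0 : ℝ) 1, Icc (0 : ℝ) 1 ∈ 𝓝 t := fun t ht => Icc_mem_nhds ht.1 ht.2
  have hPc : ∀ i j, ContinuousOn (fun s => P s i j) (Icc 0 1) := fun i j t ht =>
    (hP t ht i j).continuousWithinAt
  have hPd : ∀ t ∈ Ioo (0 : ℝ) 1, ∀ i j, HasDerivAt (fun s => P s i j) (P' t i j) t :=
    fun t ht i j => (hP t (Ioo_subset_Icc_self ht) i j).hasDerivAt (hnhds t ht)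
  have hP'd : ∀ t ∈ Ioo (0 : ℝ) 1, ∀ i j,
      HasDerivAt (fun s => P' s i j) ((-(P t * S t)) i j) t :=
    fun t ht i j => (hP'' t ht i j).hasDerivAt (hnhds t ht)
  have hP'c : ∀ i j, ContinuousOn (fun s => P' s i j) (Ico 0 1) := by
    intro i j t ht
    rcases ht.1.eq_or_lt with rfl | h0
    · have hc : ContinuousOn (fun s => (-(P s * S s)) i j) (Icc 0 1) := by
        change ContinuousOn (fun s => -∑ k, P s i k * S s k j) (Icc 0 1)
        exact (continuousOn_finsetSum _ fun k _ => (hPc i k).mul (hS_cont k j)).neg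
      obtain ⟨C, hC⟩ := isCompact_Icc.exists_bound_of_continuousOn hc
      exact continuousWithinAt_deriv_zero_of_bounded (fun s hs => hP s hs i j)
        (fun s hs => hP'd s hs i j) fun s hs => hC s (Ioo_subset_Icc_self hs)
    · exact (hP'd t ⟨h0, ht.2⟩ i j).continuousAt.continuousWithinAt
  have hu : ∀ t ∈ Ico (0 : ℝ) 1, IsUnit (P t) := by
    intro t ht
    rcases ht.1.eq_or_lt with rfl | h0
    · rw [hP0]; exact isUnit_one
    · exact hP_inv t ⟨h0, ht.2⟩
  have hle : ∀ t ∈ Ico (0 : ℝ) 1, (P t).det ≤ (1 + t • B).det := fun t ht =>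
    det_le_det_one_add_smul_of_jacobi (fun s hs => hS_psd s (Ioo_subset_Icc_self hs))
      (fun i j => (hPc i j).mono Ico_subset_Icc_self) hP'c hPd hP'd hP0 hP'0 hB_symm hB_psd hu ht
  have hdc : ContinuousOn (fun s => (P s).det) (Icc 0 1) := by
    simp only [det_apply']
    exact continuousOn_finsetSum _ fun σ _ =>
      continuousOn_const.mul (continuousOn_finsetProd _ fun i _ => hPc _ _)
  have hgc : Continuous fun s : ℝ => (1 + s • B).det := by fun_prop
  have : (𝓝[Ico (0 : ℝ) 1] 1).NeBot := by
    rw [← mem_closure_iff_nhdsWithin_neBot, closure_Ico zero_ne_one]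
    exact ⟨zero_le_one, le_rfl⟩
  have h1 : Tendsto (fun s => (P s).det) (𝓝[Ico (0 : ℝ) 1] 1) (𝓝 (P 1).det) :=
    (hdc 1 ⟨zero_le_one, le_rfl⟩).mono Ico_subset_Icc_self
  have h2 : Tendsto (fun s : ℝ => (1 + s • B).det) (𝓝[Ico (0 : ℝ) 1] 1) (𝓝 (1 + B).det) := by
    simpa using (hgc.tendsto 1).mono_left nhdsWithin_le_nhds
  exact le_of_tendsto_of_tendsto h1 h2 (eventually_mem_nhdsWithin.mono hle)
end
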